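/- Let K ≥ 2, let α ∈ ℝ^K with α_k > 0 for all k, let α_0 = Σ_k α_k, let μ, ν > 0, let i ≠ j be indices in {1,…,K}, and set η = μα_i / (μα_i + να_j). Then: (a) ∫_0^1 ∫_Δ θ_i · L_{ij}(θ,ρ) · D_α(θ) · W_{μ,ν}(ρ) dθ dρ = [η·(α_i+1)(α_i+α_j)/(α_0(α_i+α_j+1)) + (1−η)·α_i(α_i+α_j)/(α_0(α_i+α_j+1))] · ∫_0^1 ∫_Δ L_{ij}(θ,ρ) · D_α(θ) · W_{μ,ν}(ρ) dθ dρ; (b) ∫_0^1 ∫_Δ θ_j · L_{ij} · D_α · W_{μ,ν} dθ dρ = [η·α_j(α_i+α_j)/(α_0(α_i+α_j+1)) + (1−η)·(α_j+1)(α_i+α_j)/(α_0(α_i+α_j+1))] · ∫_0^1 ∫_Δ L_{ij} · D_α · W_{μ,ν} dθ dρ; (c) for every index k with k ≠ i and k ≠ j, ∫_0^1 ∫_Δ θ_k · L_{ij} · D_α · W_{μ,ν} dθ dρ = (α_k/α_0) · ∫_0^1 ∫_Δ L_{ij} · D_α · W_{μ,ν} dθ dρ. -/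

import Mathlib

open MeasureTheory Finset

/-- The parametrizing domain `{y ∈ ℝ^{K-1} : y_k > 0, Σ y_k < 1}` of the open
probability simplex on `K` coordinates. -/
def simplexDomain (K : ℕ) : Set (Fin (K - 1) → ℝ) :=
  {y | (∀ k, 0 < y k) ∧ ∑ k, y k < 1}

/-- The point of the simplex with coordinates `θ_k = y_k` for `k < K-1` and
`θ_K = 1 - Σ y_k`. -/
noncomputable def coordsOf {K : ℕ} (y : Fin (K - 1) → ℝ) : Fin K → ℝ :=
  fun i => if h : (i : ℕ) < K - 1 then y ⟨(i : ℕ), h⟩ else 1 - ∑ k, y k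

/-- The unnormalized Dirichlet density `D_α(θ) = ∏ θ_k^(α_k - 1)`. -/
noncomputable def dirDensity {K : ℕ} (α : Fin K → ℝ) (θ : Fin K → ℝ) : ℝ :=
  ∏ k, θ k ^ (α k - 1)

/-- The unnormalized Beta density `W_{μ,ν}(ρ) = ρ^(μ-1) (1-ρ)^(ν-1)`. -/
noncomputable def betaDensity (μ ν ρ : ℝ) : ℝ :=
  ρ ^ (μ - 1) * (1 - ρ) ^ (ν - 1)

/-- `L_{ij}(θ,ρ) = ρ θ_i/(θ_i+θ_j) + (1-ρ) θ_j/(θ_i+θ_j)`, the probability that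
a worker of reliability `ρ` prefers item `i` to item `j`. -/
noncomputable def likeL {K : ℕ} (i j : Fin K) (θ : Fin K → ℝ) (ρ : ℝ) : ℝ :=
  ρ * (θ i / (θ i + θ j)) + (1 - ρ) * (θ j / (θ i + θ j))

/-- `∫_0^1 ∫_Δ f(θ,ρ) dθ dρ`, the double integral over the simplex (via the
standard parametrization) and the unit interval. -/
noncomputable def dblIntegral (K : ℕ) (f : (Fin K → ℝ) → ℝ → ℝ) : ℝ :=
  ∫ ρ in Set.Ioo (0:ℝ) 1, ∫ y in simplexDomain K, f (coordsOf y) ρ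

/-- Splitting off the last coordinate of `ℝ^{n+1}` and replacing it by the coordinate sum. -/
theorem lintegral_eq_lintegral_sum_slices {n : ℕ} {G : (Fin (n + 1) → ℝ) → ENNReal}
    (hG : Measurable G) :
    ∫⁻ x, G x = ∫⁻ s : ℝ, ∫⁻ y : Fin n → ℝ, G (Fin.snoc y (s - ∑ k, y k)) := by
  have hsnoc : Measurable fun p : (Fin n → ℝ) × ℝ => (Fin.snoc p.1 p.2 : Fin (n + 1) → ℝ) := by
    refine measurable_pi_iff.2 fun k => ?_
    refine Fin.lastCases ?_ (fun k => ?_) k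
    · simpa using measurable_snd
    · simpa [Function.comp_def] using (measurable_pi_apply k).comp measurable_fst
  have hsum : Measurable fun y : Fin n → ℝ => ∑ k, y k :=
    Finset.measurable_fun_sum _ fun k _ => measurable_pi_apply k
  have e := (volume_preserving_piFinSuccAbove (fun _ : Fin (n + 1) => ℝ) (Fin.last n)).symm
  rw [← e.lintegral_comp_emb (MeasurableEquiv.measurableEmbedding _) G, Measure.volume_eq_prod,
    lintegral_prod_symm' _ (by exact hG.comp (MeasurableEquiv.measurable _))]
  have hslice : ∀ y : Fin n → ℝ,
      ∫⁻ t : ℝ, G ((MeasurableEquiv.piFinSuccAbove (fun _ : Fin (n + 1) => ℝ)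
        (Fin.last n)).symm (t, y)) = ∫⁻ s : ℝ, G (Fin.snoc y (s - ∑ k, y k)) := by
    intro y
    rw [lintegral_sub_right_eq_self (fun t : ℝ => G (Fin.snoc y t)) (∑ k, y k)]
    refine lintegral_congr fun t => ?_
    congr 1
    exact Fin.insertNth_last' t y
  simp_rw [hslice]
  refine lintegral_lintegral_swap (Measurable.aemeasurable ?_)
  exact hG.comp (hsnoc.comp (measurable_fst.prodMk (measurable_snd.sub (hsum.comp measurable_fst))))

theorem lintegral_eq_pow_mul_lintegral_smul {n : ℕ} {H : (Fin n → ℝ) → ENNReal}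
    (hH : Measurable H) {s : ℝ} (hs : 0 < s) :
    ∫⁻ y, H y = ENNReal.ofReal (s ^ n) * ∫⁻ y, H (s • y) := by
  rw [← lintegral_map (g := fun y : Fin n → ℝ => s • y) hH (measurable_const_smul s),
    Measure.map_addHaar_smul volume hs.ne', lintegral_smul_measure, smul_eq_mul, ← mul_assoc,
    ← ENNReal.ofReal_mul (by positivity), Module.finrank_fin_fun, abs_of_pos (by positivity),
    mul_inv_cancel₀ (by positivity), ENNReal.ofReal_one, one_mul]

theorem coordsOf_eq_snoc {n : ℕ} (y : Fin n → ℝ) :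
    coordsOf (K := n + 1) y = Fin.snoc y (1 - ∑ k, y k) := by
  funext k
  refine Fin.lastCases ?_ (fun k => ?_) k <;> simp [coordsOf]

theorem coordsOf_pos {K : ℕ} {y : Fin (K - 1) → ℝ} (hy : y ∈ simplexDomain K) (k : Fin K) :
    0 < coordsOf y k := by
  unfold coordsOf
  split_ifs
  · exact hy.1 _
  · exact sub_pos.2 hy.2

theorem sum_coordsOf {n : ℕ} (y : Fin n → ℝ) : ∑ k, coordsOf (K := n + 1) y k = 1 := by
  rw [coordsOf_eq_snoc, Fin.sum_univ_castSucc]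
  simp

theorem measurable_coordsOf {K : ℕ} :
    Measurable (coordsOf : (Fin (K - 1) → ℝ) → Fin K → ℝ) := by
  refine measurable_pi_iff.2 fun k => ?_
  unfold coordsOf
  split_ifs
  · exact measurable_pi_apply _
  · exact measurable_const.sub (Finset.measurable_fun_sum _ fun k _ => measurable_pi_apply k)

theorem measurableSet_simplexDomain (K : ℕ) : MeasurableSet (simplexDomain K) := by
  have : simplexDomain K = (⋂ k, {y | 0 < y k}) ∩ {y | ∑ k, y k < 1} := by
    ext y; simp [simplexDomain]
  rw [this]
  exact (MeasurableSet.iInter fun k => measurableSet_lt measurable_const (measurable_pi_apply k)).inter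
    (measurableSet_lt (Finset.measurable_fun_sum _ fun k _ => measurable_pi_apply k)
      measurable_const)

/-- Polar coordinates on the positive orthant with respect to the open simplex. -/
theorem lintegral_orthant_eq_lintegral_simplex {n : ℕ} {F : (Fin (n + 1) → ℝ) → ENNReal}
    (hF : Measurable F) :
    ∫⁻ x in Set.univ.pi fun _ => Set.Ioi (0 : ℝ), F x =
      ∫⁻ s in Set.Ioi (0 : ℝ), ENNReal.ofReal (s ^ n) *
        ∫⁻ y in simplexDomain (n + 1), F (s • coordsOf y) := by
  have hO : MeasurableSet (Set.univ.pi fun _ : Fin (n + 1) => Set.Ioi (0 : ℝ)) :=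
    MeasurableSet.univ_pi fun _ => measurableSet_Ioi
  have hsum : Measurable fun y : Fin n → ℝ => ∑ k, y k :=
    Finset.measurable_fun_sum _ fun k _ => measurable_pi_apply k
  rw [← lintegral_indicator hO, lintegral_eq_lintegral_sum_slices (hF.indicator hO),
    ← lintegral_indicator measurableSet_Ioi]
  refine lintegral_congr fun s => ?_
  by_cases hs : 0 < s
  · rw [Set.indicator_of_mem (Set.mem_Ioi.2 hs)]
    have hmeas : Measurable fun y : Fin n → ℝ => (Fin.snoc y (s - ∑ k, y k) : Fin (n + 1) → ℝ) := by
      refine measurable_pi_iff.2 fun k => ?_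
      refine Fin.lastCases ?_ (fun k => ?_) k
      · simpa using hsum.const_sub s
      · simpa using measurable_pi_apply k
    refine (lintegral_eq_pow_mul_lintegral_smul ((hF.indicator hO).comp hmeas) hs).trans ?_
    rw [← lintegral_indicator (measurableSet_simplexDomain _)]
    congr 1
    refine lintegral_congr fun y => ?_
    rw [Function.comp_apply]
    have hsnoc : (Fin.snoc (s • y) (s - ∑ k, (s • y) k) : Fin (n + 1) → ℝ)
        = s • coordsOf (K := n + 1) y := by
      rw [coordsOf_eq_snoc]
      funext k
      refine Fin.lastCases ?_ (fun k => ?_) k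
      · simp [mul_sub, Finset.mul_sum]
      · simp
    rw [hsnoc]
    by_cases hy : y ∈ simplexDomain (n + 1)
    · rw [Set.indicator_of_mem hy, Set.indicator_of_mem]
      intro k _
      exact mul_pos hs (coordsOf_pos hy k)
    · rw [Set.indicator_of_notMem hy, Set.indicator_of_notMem]
      intro h
      have hpos : ∀ k, 0 < coordsOf (K := n + 1) y k := fun k =>
        (mul_pos_iff_of_pos_left hs).1 (h k trivial)
      rw [coordsOf_eq_snoc] at hpos
      refine hy ⟨fun k => by simpa using hpos (Fin.castSucc k), ?_⟩
      simpa using hpos (Fin.last n)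
  · rw [Set.indicator_of_notMem (by simpa using hs)]
    refine (lintegral_congr fun y => ?_).trans lintegral_zero
    refine Set.indicator_of_notMem (fun h => hs ?_) _
    have := Finset.sum_pos (s := Finset.univ) (fun k _ => Set.mem_Ioi.1 (h k trivial)) Finset.univ_nonempty
    rw [Fin.sum_univ_castSucc] at this
    simpa using this

theorem integrableOn_rpow_mul_exp_neg_mul_Ioi {b r : ℝ} (hb : 0 < b) (hr : 0 < r) :
    IntegrableOn (fun x : ℝ => x ^ (b - 1) * Real.exp (-(r * x))) (Set.Ioi 0) := by
  refine Integrable.of_integral_ne_zero ?_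
  rw [Real.integral_rpow_mul_exp_neg_mul_Ioi hb hr]
  have := Real.Gamma_pos_of_pos hb
  positivity

theorem lintegral_rpow_mul_exp_neg_mul_Ioi {b r : ℝ} (hb : 0 < b) (hr : 0 < r) :
    ∫⁻ x in Set.Ioi (0 : ℝ), ENNReal.ofReal (x ^ (b - 1) * Real.exp (-(r * x))) =
      ENNReal.ofReal ((1 / r) ^ b * Real.Gamma b) := by
  rw [← Real.integral_rpow_mul_exp_neg_mul_Ioi hb hr, ofReal_integral_eq_lintegral_ofReal
    (integrableOn_rpow_mul_exp_neg_mul_Ioi hb hr)]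
  refine ae_restrict_of_forall_mem measurableSet_Ioi fun x (hx : 0 < x) => ?_
  simp only [Pi.zero_apply]
  positivity

theorem lintegral_orthant_prod_rpow_mul_exp {ι : Type*} [Fintype ι] {β r : ι → ℝ}
    (hβ : ∀ k, 0 < β k) (hr : ∀ k, 0 < r k) :
    ∫⁻ x in Set.univ.pi fun _ : ι => Set.Ioi (0 : ℝ),
        ENNReal.ofReal (∏ k, x k ^ (β k - 1) * Real.exp (-(r k * x k))) =
      ENNReal.ofReal (∏ k, (1 / r k) ^ β k * Real.Gamma (β k)) := by
  have hO : MeasurableSet (Set.univ.pi fun _ : ι => Set.Ioi (0 : ℝ)) :=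
    MeasurableSet.univ_pi fun _ => measurableSet_Ioi
  have hnonneg : 0 ≤ᵐ[volume.restrict (Set.univ.pi fun _ : ι => Set.Ioi (0 : ℝ))]
      fun x => ∏ k, x k ^ (β k - 1) * Real.exp (-(r k * x k)) := by
    refine ae_restrict_of_forall_mem hO fun x hx => Finset.prod_nonneg fun k _ => ?_
    have : 0 < x k := hx k trivial
    positivity
  rw [volume_pi, Measure.restrict_pi_pi] at hnonneg ⊢
  rw [← ofReal_integral_eq_lintegral_ofReal
    (Integrable.fintype_prod (f := fun k t => t ^ (β k - 1) * Real.exp (-(r k * t)))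
      fun k => integrableOn_rpow_mul_exp_neg_mul_Ioi (hβ k) (hr k)) hnonneg,
    integral_fintype_prod_eq_prod (fun k t => t ^ (β k - 1) * Real.exp (-(r k * t)))]
  simp_rw [fun k => Real.integral_rpow_mul_exp_neg_mul_Ioi (hβ k) (hr k)]

theorem lintegral_Ioi_one_add_rpow_neg {c : ℝ} (hc : 1 < c) :
    ∫⁻ t in Set.Ioi (0 : ℝ), ENNReal.ofReal ((1 / (1 + t)) ^ c) =
      ENNReal.ofReal (1 / (c - 1)) := by
  have hshift : ∫⁻ t in Set.Ioi (0 : ℝ), ENNReal.ofReal ((1 / (1 + t)) ^ c) =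
      ∫⁻ t in Set.Ioi (1 : ℝ), ENNReal.ofReal (t ^ (-c)) := by
    rw [← lintegral_indicator measurableSet_Ioi, ← lintegral_indicator measurableSet_Ioi,
      ← lintegral_add_left_eq_self (Set.indicator (Set.Ioi 1) _) (1 : ℝ)]
    refine lintegral_congr fun t => ?_
    by_cases ht : 0 < t
    · rw [Set.indicator_of_mem (Set.mem_Ioi.2 ht), Set.indicator_of_mem (by simpa using ht),
        one_div, Real.inv_rpow (by positivity), Real.rpow_neg (by positivity)]
    · rw [Set.indicator_of_notMem (by simpa using ht), Set.indicator_of_notMem (by simpa using ht)]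
  rw [hshift, ← ofReal_integral_eq_lintegral_ofReal
    (integrableOn_Ioi_rpow_of_lt (by linarith) one_pos)
    (ae_restrict_of_forall_mem measurableSet_Ioi fun t (ht : 1 < t) =>
      Real.rpow_nonneg (by linarith) _), integral_Ioi_rpow_of_lt (by linarith) one_pos]
  rw [Real.one_rpow, show -c + 1 = -(c - 1) by ring, neg_div_neg_eq]

theorem lintegral_orthant_prod_div_add {ι : Type*} [Fintype ι] [DecidableEq ι] {β : ι → ℝ}
    (hβ : ∀ k, 0 < β k) {i j : ι} (hij : i ≠ j) (h : 1 < β i + β j) :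
    ∫⁻ x in Set.univ.pi fun _ : ι => Set.Ioi (0 : ℝ),
        ENNReal.ofReal ((∏ k, x k ^ (β k - 1)) / (x i + x j) * Real.exp (-∑ k, x k)) =
      ENNReal.ofReal ((∏ k, Real.Gamma (β k)) / (β i + β j - 1)) := by
  have hO : MeasurableSet (Set.univ.pi fun _ : ι => Set.Ioi (0 : ℝ)) :=
    MeasurableSet.univ_pi fun _ => measurableSet_Ioi
  let c : ι → ℝ := fun k => if k = i ∨ k = j then 1 else 0
  let r : ℝ → ι → ℝ := fun t k => 1 + t * c k
  have hc : ∀ x : ι → ℝ, ∑ k, c k * x k = x i + x j := fun x => by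
    rw [Finset.sum_eq_add i j hij (fun k _ hk => by simp [c, hk.1, hk.2]) (by simp) (by simp)]
    simp [c]
  have hlaplace : ∀ x ∈ Set.univ.pi fun _ : ι => Set.Ioi (0 : ℝ),
      ENNReal.ofReal ((∏ k, x k ^ (β k - 1)) / (x i + x j) * Real.exp (-∑ k, x k)) =
        ∫⁻ t in Set.Ioi (0 : ℝ),
          ENNReal.ofReal (∏ k, x k ^ (β k - 1) * Real.exp (-(r t k * x k))) := by
    intro x hx
    have hpos : ∀ k, 0 < x k := fun k => hx k trivial
    have hij_pos : 0 < x i + x j := add_pos (hpos i) (hpos j)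
    have hA : 0 ≤ (∏ k, x k ^ (β k - 1)) * Real.exp (-∑ k, x k) :=
      mul_nonneg (Finset.prod_nonneg fun k _ => Real.rpow_nonneg (hpos k).le _)
        (Real.exp_pos _).le
    have hsplit : ∀ t : ℝ, ∏ k, x k ^ (β k - 1) * Real.exp (-(r t k * x k)) =
        ((∏ k, x k ^ (β k - 1)) * Real.exp (-∑ k, x k)) *
          (t ^ ((1 : ℝ) - 1) * Real.exp (-((x i + x j) * t))) := by
      intro t
      rw [Finset.prod_mul_distrib, ← Real.exp_sum, sub_self, Real.rpow_zero, one_mul, mul_assoc,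
        ← Real.exp_add]
      congr 2
      rw [← hc, Finset.sum_neg_distrib, Finset.sum_mul, ← neg_add, ← Finset.sum_add_distrib]
      congr 1
      refine Finset.sum_congr rfl fun k _ => ?_
      simp only [r]
      ring
    simp_rw [hsplit, ENNReal.ofReal_mul hA]
    rw [lintegral_const_mul _ (by fun_prop), lintegral_rpow_mul_exp_neg_mul_Ioi one_pos hij_pos,
      ← ENNReal.ofReal_mul hA]
    congr 1
    rw [Real.rpow_one, Real.Gamma_one]
    ring
  have hprod : ∀ t ∈ Set.Ioi (0 : ℝ),
      ENNReal.ofReal (∏ k, (1 / r t k) ^ β k * Real.Gamma (β k)) =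
        ENNReal.ofReal (∏ k, Real.Gamma (β k)) * ENNReal.ofReal ((1 / (1 + t)) ^ (β i + β j)) := by
    intro t (ht : 0 < t)
    rw [← ENNReal.ofReal_mul (Finset.prod_nonneg fun k _ => (Real.Gamma_pos_of_pos (hβ k)).le),
      Finset.prod_mul_distrib, mul_comm, Real.rpow_add (by positivity),
      Finset.prod_eq_mul (f := fun k => (1 / r t k) ^ β k) i j hij
        (fun k _ hk => by simp [r, c, hk.1, hk.2]) (by simp) (by simp)]
    simp [r, c]
  rw [setLIntegral_congr_fun hO hlaplace, lintegral_lintegral_swap (Measurable.aemeasurable ?_)]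
  · rw [setLIntegral_congr_fun measurableSet_Ioi fun t (ht : 0 < t) =>
      (lintegral_orthant_prod_rpow_mul_exp hβ fun k => ?_).trans (hprod t ht),
      lintegral_const_mul _ (by fun_prop), lintegral_Ioi_one_add_rpow_neg h,
      ← ENNReal.ofReal_mul (Finset.prod_nonneg fun k _ => (Real.Gamma_pos_of_pos (hβ k)).le),
      mul_one_div]
    simp only [r, c]
    split_ifs <;> linarith
  · simp only [Function.uncurry_def, r]
    fun_prop

theorem lintegral_simplex_dirDensity_div_add {n : ℕ} {β : Fin (n + 1) → ℝ} (hβ : ∀ k, 0 < β k)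
    {i j : Fin (n + 1)} (hij : i ≠ j) (h : 1 < β i + β j) :
    ∫⁻ y in simplexDomain (n + 1),
        ENNReal.ofReal (dirDensity β (coordsOf y) / (coordsOf y i + coordsOf y j)) =
      ENNReal.ofReal ((∏ k, Real.Gamma (β k)) / ((β i + β j - 1) * Real.Gamma (∑ k, β k - 1))) := by
  have hsum : 0 < ∑ k, β k - 1 := by
    have := Finset.add_le_sum (fun k _ => (hβ k).le) (Finset.mem_univ i) (Finset.mem_univ j) hij
    linarith
  have hΓ := Real.Gamma_pos_of_pos hsum
  have hscale : ∀ s ∈ Set.Ioi (0 : ℝ), ENNReal.ofReal (s ^ n) * (∫⁻ y in simplexDomain (n + 1),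
      ENNReal.ofReal ((∏ k, (s • coordsOf y) k ^ (β k - 1)) /
        ((s • coordsOf y) i + (s • coordsOf y) j) * Real.exp (-∑ k, (s • coordsOf y) k))) =
      ENNReal.ofReal (s ^ ((∑ k, β k - 1) - 1) * Real.exp (-(1 * s))) *
        ∫⁻ y in simplexDomain (n + 1),
          ENNReal.ofReal (dirDensity β (coordsOf y) / (coordsOf y i + coordsOf y j)) := by
    intro s (hs : 0 < s)
    rw [← lintegral_const_mul' _ _ ENNReal.ofReal_ne_top,
      ← lintegral_const_mul' _ _ ENNReal.ofReal_ne_top]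
    refine setLIntegral_congr_fun (measurableSet_simplexDomain _) fun y hy => ?_
    have hθ := coordsOf_pos hy
    rw [← ENNReal.ofReal_mul (by positivity), ← ENNReal.ofReal_mul (by positivity)]
    congr 1
    simp only [Pi.smul_apply, smul_eq_mul, dirDensity]
    rw [← Finset.mul_sum, sum_coordsOf, ← mul_add, mul_one, one_mul,
      Finset.prod_congr rfl fun k _ => Real.mul_rpow hs.le (hθ k).le, Finset.prod_mul_distrib,
      ← Real.rpow_sum_of_pos hs]
    have hexp : s ^ ((∑ k, β k - 1) - 1) = s ^ n * s ^ (∑ k, (β k - 1)) / s := by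
      rw [← Real.rpow_natCast, ← Real.rpow_add hs, ← Real.rpow_sub_one hs.ne']
      congr 1
      simp
      ring
    rw [hexp]
    have := hθ i
    have := hθ j
    field_simp
  have key := lintegral_orthant_prod_div_add hβ hij h
  rw [lintegral_orthant_eq_lintegral_simplex (by fun_prop),
    setLIntegral_congr_fun measurableSet_Ioi hscale, lintegral_mul_const _ (by fun_prop),
    lintegral_rpow_mul_exp_neg_mul_Ioi hsum one_pos] at key
  simp only [div_one, Real.one_rpow, one_mul] at key
  rw [← div_div, ENNReal.ofReal_div_of_pos hΓ, ← key, mul_comm,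
    ENNReal.mul_div_cancel_right (by simpa using hΓ) ENNReal.ofReal_ne_top]

theorem measurable_dirDensity {K : ℕ} (β : Fin K → ℝ) : Measurable (dirDensity β) := by
  unfold dirDensity
  fun_prop

theorem dirDensity_pos {K : ℕ} (β : Fin K → ℝ) {θ : Fin K → ℝ} (hθ : ∀ k, 0 < θ k) :
    0 < dirDensity β θ :=
  Finset.prod_pos fun k _ => Real.rpow_pos_of_pos (hθ k) _

theorem integral_simplex_dirDensity_div_add {K : ℕ} {β : Fin K → ℝ} (hβ : ∀ k, 0 < β k)
    {i j : Fin K} (hij : i ≠ j) (h : 1 < β i + β j) :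
    ∫ y in simplexDomain K, dirDensity β (coordsOf y) / (coordsOf y i + coordsOf y j) =
      (∏ k, Real.Gamma (β k)) / ((β i + β j - 1) * Real.Gamma (∑ k, β k - 1)) := by
  obtain _ | n := K
  · exact i.elim0
  have hsum : 0 < ∑ k, β k - 1 := by
    have := Finset.add_le_sum (fun k _ => (hβ k).le) (Finset.mem_univ i) (Finset.mem_univ j) hij
    linarith
  rw [integral_eq_lintegral_of_nonneg_ae, lintegral_simplex_dirDensity_div_add hβ hij h,
    ENNReal.toReal_ofReal]
  · exact div_nonneg (Finset.prod_nonneg fun k _ => (Real.Gamma_pos_of_pos (hβ k)).le)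
      (mul_nonneg (by linarith) (Real.Gamma_pos_of_pos hsum).le)
  · exact ae_restrict_of_forall_mem (measurableSet_simplexDomain _) fun y hy =>
      div_nonneg (dirDensity_pos β (coordsOf_pos hy)).le
        (add_pos (coordsOf_pos hy i) (coordsOf_pos hy j)).le
  · have hm : Measurable fun θ : Fin (n + 1) → ℝ => dirDensity β θ / (θ i + θ j) :=
      (measurable_dirDensity β).div ((measurable_pi_apply i).add (measurable_pi_apply j))
    exact (hm.comp measurable_coordsOf).aestronglyMeasurable

theorem integrableOn_simplex_dirDensity_div_add {K : ℕ} {β : Fin K → ℝ} (hβ : ∀ k, 0 < β k)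
    {i j : Fin K} (hij : i ≠ j) (h : 1 < β i + β j) :
    IntegrableOn (fun y => dirDensity β (coordsOf y) / (coordsOf y i + coordsOf y j))
      (simplexDomain K) := by
  have hsum : 0 < ∑ k, β k - 1 := by
    have := Finset.add_le_sum (fun k _ => (hβ k).le) (Finset.mem_univ i) (Finset.mem_univ j) hij
    linarith
  refine Integrable.of_integral_ne_zero ?_
  rw [integral_simplex_dirDensity_div_add hβ hij h]
  exact div_ne_zero (Finset.prod_ne_zero_iff.2 fun k _ => (Real.Gamma_pos_of_pos (hβ k)).ne')
    (mul_ne_zero (by linarith) (Real.Gamma_pos_of_pos hsum).ne')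

theorem integral_betaDensity {μ ν : ℝ} (hμ : 0 < μ) (hν : 0 < ν) :
    ∫ ρ in Set.Ioo (0 : ℝ) 1, betaDensity μ ν ρ = ProbabilityTheory.beta μ ν := by
  rw [ProbabilityTheory.beta_eq_betaIntegralReal μ ν hμ hν, Complex.betaIntegral,
    intervalIntegral.integral_of_le zero_le_one, ← integral_Ioc_eq_integral_Ioo]
  have hcast : ∀ ρ ∈ Set.Ioc (0 : ℝ) 1,
      (ρ : ℂ) ^ ((μ : ℂ) - 1) * (1 - (ρ : ℂ)) ^ ((ν : ℂ) - 1) = (betaDensity μ ν ρ : ℂ) := by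
    intro ρ hρ
    have : 0 ≤ 1 - ρ := sub_nonneg.2 hρ.2
    rw [betaDensity, Complex.ofReal_mul, Complex.ofReal_cpow hρ.1.le, Complex.ofReal_cpow this]
    push_cast
    rfl
  rw [setIntegral_congr_fun measurableSet_Ioc hcast, integral_complex_ofReal, Complex.ofReal_re]

theorem integrableOn_betaDensity {μ ν : ℝ} (hμ : 0 < μ) (hν : 0 < ν) :
    IntegrableOn (betaDensity μ ν) (Set.Ioo (0 : ℝ) 1) := by
  refine Integrable.of_integral_ne_zero ?_
  rw [integral_betaDensity hμ hν]
  exact (ProbabilityTheory.beta_pos hμ hν).ne'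

theorem beta_add_one_left {μ ν : ℝ} (hμ : 0 < μ) (hν : 0 < ν) :
    ProbabilityTheory.beta (μ + 1) ν = μ / (μ + ν) * ProbabilityTheory.beta μ ν := by
  have := Real.Gamma_pos_of_pos (add_pos hμ hν)
  rw [ProbabilityTheory.beta, ProbabilityTheory.beta, Real.Gamma_add_one hμ.ne',
    show μ + 1 + ν = μ + ν + 1 by ring, Real.Gamma_add_one (by positivity)]
  field_simp

theorem beta_add_one_right {μ ν : ℝ} (hμ : 0 < μ) (hν : 0 < ν) :
    ProbabilityTheory.beta μ (ν + 1) = ν / (μ + ν) * ProbabilityTheory.beta μ ν := by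
  have := Real.Gamma_pos_of_pos (add_pos hμ hν)
  rw [ProbabilityTheory.beta, ProbabilityTheory.beta, Real.Gamma_add_one hν.ne',
    ← add_assoc, Real.Gamma_add_one (by positivity)]
  field_simp

theorem dblIntegral_congr {K : ℕ} {f g : (Fin K → ℝ) → ℝ → ℝ}
    (h : ∀ θ ρ, (∀ k, 0 < θ k) → 0 < ρ → ρ < 1 → f θ ρ = g θ ρ) :
    dblIntegral K f = dblIntegral K g :=
  setIntegral_congr_fun measurableSet_Ioo fun ρ hρ =>
    setIntegral_congr_fun (measurableSet_simplexDomain K) fun _ hy =>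
      h _ ρ (coordsOf_pos hy) hρ.1 hρ.2

theorem mul_dirDensity {K : ℕ} (α : Fin K → ℝ) {θ : Fin K → ℝ} (hθ : ∀ k, 0 < θ k) (k : Fin K) :
    θ k * dirDensity α θ = dirDensity (α + Pi.single k 1) θ := by
  have hsingle : θ k = ∏ l, θ l ^ (Pi.single k 1 : Fin K → ℝ) l := by
    rw [Fintype.prod_eq_single k fun l hl => by simp [hl]]
    simp
  rw [hsingle, dirDensity, dirDensity, ← Finset.prod_mul_distrib]
  refine Finset.prod_congr rfl fun l _ => ?_
  rw [← Real.rpow_add (hθ l), Pi.add_apply]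
  ring_nf

theorem add_single_pos {K : ℕ} {α : Fin K → ℝ} (hα : ∀ k, 0 < α k) (k l : Fin K) :
    0 < (α + Pi.single k 1 : Fin K → ℝ) l := by
  have := hα l
  by_cases h : l = k
  · subst h; simp; linarith
  · simpa [h]

theorem sum_add_single {K : ℕ} (α : Fin K → ℝ) (k : Fin K) :
    ∑ l, (α + Pi.single k 1 : Fin K → ℝ) l = ∑ l, α l + 1 := by
  simp [Finset.sum_add_distrib]

theorem prod_Gamma_add_single {K : ℕ} {α : Fin K → ℝ} (hα : ∀ k, 0 < α k) (k : Fin K) :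
    ∏ l, Real.Gamma ((α + Pi.single k 1 : Fin K → ℝ) l) = α k * ∏ l, Real.Gamma (α l) := by
  rw [← Finset.mul_prod_erase _ _ (Finset.mem_univ k),
    ← Finset.mul_prod_erase _ (fun l => Real.Gamma (α l)) (Finset.mem_univ k), ← mul_assoc,
    ← Real.Gamma_add_one (hα k).ne', Pi.add_apply, Pi.single_eq_same]
  congr 1
  refine Finset.prod_congr rfl fun l hl => ?_
  simp [Finset.ne_of_mem_erase hl]

/-- The evidence of one comparison, in closed form. -/
theorem dblIntegral_likeL_mul_dirDensity_mul_betaDensity {K : ℕ} {α : Fin K → ℝ}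
    (hα : ∀ k, 0 < α k) {μ ν : ℝ} (hμ : 0 < μ) (hν : 0 < ν) {i j : Fin K} (hij : i ≠ j) :
    dblIntegral K (fun θ ρ => likeL i j θ ρ * dirDensity α θ * betaDensity μ ν ρ) =
      ProbabilityTheory.beta μ ν * (∏ k, Real.Gamma (α k)) / Real.Gamma (∑ k, α k) *
        ((μ * α i + ν * α j) / ((μ + ν) * (α i + α j))) := by
  have hi := hα i
  have hj := hα j
  have hi_lt : 1 < (α + Pi.single i 1 : Fin K → ℝ) i + (α + Pi.single i 1 : Fin K → ℝ) j := by
    simp [hij.symm]; linarith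
  have hj_lt : 1 < (α + Pi.single j 1 : Fin K → ℝ) i + (α + Pi.single j 1 : Fin K → ℝ) j := by
    simp [hij]; linarith
  have hμ1 : 0 < μ + 1 := by linarith
  have hν1 : 0 < ν + 1 := by linarith
  have hinner : ∀ ρ ∈ Set.Ioo (0 : ℝ) 1,
      ∫ y in simplexDomain K, likeL i j (coordsOf y) ρ * dirDensity α (coordsOf y) *
          betaDensity μ ν ρ =
        betaDensity (μ + 1) ν ρ * (∫ y in simplexDomain K,
          dirDensity (α + Pi.single i 1) (coordsOf y) / (coordsOf y i + coordsOf y j)) +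
        betaDensity μ (ν + 1) ρ * ∫ y in simplexDomain K,
          dirDensity (α + Pi.single j 1) (coordsOf y) / (coordsOf y i + coordsOf y j) := by
    intro ρ hρ
    have hρ1 : 0 < 1 - ρ := sub_pos.2 hρ.2
    have hρμ : betaDensity (μ + 1) ν ρ = ρ * betaDensity μ ν ρ := by
      rw [betaDensity, betaDensity, add_sub_right_comm, Real.rpow_add_one hρ.1.ne']
      ring
    have hρν : betaDensity μ (ν + 1) ρ = (1 - ρ) * betaDensity μ ν ρ := by
      rw [betaDensity, betaDensity, add_sub_right_comm, Real.rpow_add_one hρ1.ne']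
      ring
    rw [← integral_const_mul, ← integral_const_mul, ← integral_add
      ((integrableOn_simplex_dirDensity_div_add (add_single_pos hα i) hij hi_lt).const_mul _)
      ((integrableOn_simplex_dirDensity_div_add (add_single_pos hα j) hij hj_lt).const_mul _)]
    refine setIntegral_congr_fun (measurableSet_simplexDomain K) fun y hy => ?_
    simp only [← mul_dirDensity α (coordsOf_pos hy), hρμ, hρν, likeL]
    ring
  rw [dblIntegral, setIntegral_congr_fun measurableSet_Ioo hinner,
    integral_add ((integrableOn_betaDensity hμ1 hν).mul_const _)
      ((integrableOn_betaDensity hμ hν1).mul_const _),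
    integral_mul_const, integral_mul_const, integral_betaDensity hμ1 hν,
    integral_betaDensity hμ hν1, beta_add_one_left hμ hν, beta_add_one_right hμ hν,
    integral_simplex_dirDensity_div_add (add_single_pos hα i) hij hi_lt,
    integral_simplex_dirDensity_div_add (add_single_pos hα j) hij hj_lt,
    prod_Gamma_add_single hα, prod_Gamma_add_single hα, sum_add_single, sum_add_single,
    add_sub_cancel_right]
  have hΓ : 0 < Real.Gamma (∑ k, α k) :=
    Real.Gamma_pos_of_pos (Finset.sum_pos (fun k _ => hα k) ⟨i, Finset.mem_univ i⟩)
  have hadd_i : (α + Pi.single i 1 : Fin K → ℝ) i + (α + Pi.single i 1 : Fin K → ℝ) j - 1 = α i + α j := by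
    simp [hij.symm]; ring
  have hadd_j : (α + Pi.single j 1 : Fin K → ℝ) i + (α + Pi.single j 1 : Fin K → ℝ) j - 1 = α i + α j := by
    simp [hij]; ring
  rw [hadd_i, hadd_j]
  field_simp

theorem dblIntegral_mul_likeL_mul_dirDensity_mul_betaDensity {K : ℕ} {α : Fin K → ℝ}
    (hα : ∀ k, 0 < α k) {μ ν : ℝ} (hμ : 0 < μ) (hν : 0 < ν) {i j : Fin K} (hij : i ≠ j)
    (k : Fin K) :
    dblIntegral K (fun θ ρ => θ k * (likeL i j θ ρ * dirDensity α θ * betaDensity μ ν ρ)) =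
      ProbabilityTheory.beta μ ν * (∏ k, Real.Gamma (α k)) / Real.Gamma (∑ k, α k) *
        (α k / ∑ k, α k) * ((μ * (α + Pi.single k 1 : Fin K → ℝ) i + ν * (α + Pi.single k 1 : Fin K → ℝ) j) /
          ((μ + ν) * ((α + Pi.single k 1 : Fin K → ℝ) i + (α + Pi.single k 1 : Fin K → ℝ) j))) := by
  have hsum : 0 < ∑ k, α k := Finset.sum_pos (fun k _ => hα k) ⟨i, Finset.mem_univ i⟩
  rw [dblIntegral_congr (g := fun θ ρ =>
      likeL i j θ ρ * dirDensity (α + Pi.single k 1) θ * betaDensity μ ν ρ)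
      fun θ ρ hθ _ _ => by rw [← mul_dirDensity α hθ]; ring,
    dblIntegral_likeL_mul_dirDensity_mul_betaDensity (add_single_pos hα k) hμ hν hij,
    prod_Gamma_add_single hα, sum_add_single, Real.Gamma_add_one hsum.ne']
  have := Real.Gamma_pos_of_pos hsum
  congr 1
  field_simp

/-- Posterior first moments of the item scores after one comparison by a worker
with Beta(μ,ν)-distributed reliability, in which item `i` is preferred to `j`. -/
theorem heterogeneous_posterior_first_moments (K : ℕ) (hK : 2 ≤ K)
    (α : Fin K → ℝ) (hα : ∀ k, 0 < α k) (μ ν : ℝ) (hμ : 0 < μ) (hν : 0 < ν)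
    (i j : Fin K) (hij : i ≠ j) (η : ℝ) (hη : η = μ * α i / (μ * α i + ν * α j)) :
    (dblIntegral K (fun θ ρ => θ i * (likeL i j θ ρ * dirDensity α θ * betaDensity μ ν ρ))
      = (η * ((α i + 1) * (α i + α j) / ((∑ k, α k) * (α i + α j + 1)))
          + (1 - η) * (α i * (α i + α j) / ((∑ k, α k) * (α i + α j + 1))))
        * dblIntegral K (fun θ ρ => likeL i j θ ρ * dirDensity α θ * betaDensity μ ν ρ)) ∧
    (dblIntegral K (fun θ ρ => θ j * (likeL i j θ ρ * dirDensity α θ * betaDensity μ ν ρ))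
      = (η * (α j * (α i + α j) / ((∑ k, α k) * (α i + α j + 1)))
          + (1 - η) * ((α j + 1) * (α i + α j) / ((∑ k, α k) * (α i + α j + 1))))
        * dblIntegral K (fun θ ρ => likeL i j θ ρ * dirDensity α θ * betaDensity μ ν ρ)) ∧
    (∀ k : Fin K, k ≠ i → k ≠ j →
      dblIntegral K (fun θ ρ => θ k * (likeL i j θ ρ * dirDensity α θ * betaDensity μ ν ρ))
        = (α k / ∑ k', α k')
          * dblIntegral K (fun θ ρ => likeL i j θ ρ * dirDensity α θ * betaDensity μ ν ρ)) := by
  have hsum : 0 < ∑ k, α k := Finset.sum_pos (fun k _ => hα k) ⟨i, Finset.mem_univ i⟩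
  have hi := hα i
  have hj := hα j
  have hη' : 1 - η = ν * α j / (μ * α i + ν * α j) := by
    rw [hη]
    field_simp
    ring
  rw [hη', hη]
  simp only [dblIntegral_mul_likeL_mul_dirDensity_mul_betaDensity hα hμ hν hij,
    dblIntegral_likeL_mul_dirDensity_mul_betaDensity hα hμ hν hij]
  refine ⟨?_, ?_, fun k hki hkj => ?_⟩
  · simp only [Pi.add_apply, Pi.single_eq_same, Pi.single_eq_of_ne hij.symm, add_zero]
    rw [show α i + 1 + α j = α i + α j + 1 by ring]
    field_simp
  · simp only [Pi.add_apply, Pi.single_eq_same, Pi.single_eq_of_ne hij, add_zero]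
    rw [show α i + (α j + 1) = α i + α j + 1 by ring]
    field_simp
  · simp only [Pi.add_apply, Pi.single_eq_of_ne hki.symm, Pi.single_eq_of_ne hkj.symm, add_zero]
    ring
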